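/- Let m,k,h be positive integers with (m+1) | k and m | h, and let D = (h^{↑k−1},h^{↑k−2},…,h^{↑0}), i.e., D = {(i,j) ∈ ℕ² : 0 ≤ i ≤ k−1, k−1−i ≤ j ≤ k+h−2−i}. Then the system L = L_D(m^{×2kh/(m(m+1))}) is non-special and vdim L = −1. -/

import Mathlib

open MvPolynomial

/-- The differential operator `∂^{β₁}_X ∂^{β₂}_Y` on `K[X,Y]` (with `X` the variable `0`
and `Y` the variable `1`). -/
noncomputable def derivOp (K : Type*) [CommRing K] (β : ℕ × ℕ) :
    Module.End K (MvPolynomial (Fin 2) K) :=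
  ((pderiv (0 : Fin 2)).toLinearMap ^ β.1) * ((pderiv (1 : Fin 2)).toLinearMap ^ β.2)

/-- Evaluation of a polynomial in `K[X,Y]` at a point of `K²`, as a linear map. -/
noncomputable def evalPt (K : Type*) [CommRing K] (p : K × K) :
    MvPolynomial (Fin 2) K →ₗ[K] K :=
  (MvPolynomial.aeval (fun i : Fin 2 => if i = 0 then p.1 else p.2)).toLinearMap

/-- The space of polynomials whose monomial support is contained in the diagram `D`. -/
noncomputable def monoSpan (K : Type*) [Field K] (D : Finset (ℕ × ℕ)) :
    Submodule K (MvPolynomial (Fin 2) K) :=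
  Submodule.span K ((fun d : ℕ × ℕ =>
    (monomial (Finsupp.single (0 : Fin 2) d.1 + Finsupp.single 1 d.2) (1 : K))) '' D)

/-- `L_D(m₁p₁, …, m_rp_r)`: the space of polynomials supported on `D` whose partial
derivatives of total order `< m j` all vanish at the point `p j`, for `j = 1, …, r`. -/
noncomputable def linSysPts (K : Type*) [Field K] (D : Finset (ℕ × ℕ)) {r : ℕ}
    (m : Fin r → ℕ) (p : Fin r → K × K) : Submodule K (MvPolynomial (Fin 2) K) :=
  monoSpan K D ⊓ ⨅ j : Fin r, ⨅ β : ℕ × ℕ, ⨅ _ : β.1 + β.2 < m j,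
    LinearMap.ker (evalPt K (p j) ∘ₗ derivOp K β)

/-- `dim L_D(m₁,…,m_r)`: the minimum over all tuples of points of `dim_K L − 1`. -/
noncomputable def dimSys (K : Type*) [Field K] (D : Finset (ℕ × ℕ)) {r : ℕ}
    (m : Fin r → ℕ) : ℤ :=
  sInf (Set.range fun p : Fin r → K × K =>
    (Module.finrank K ↥(linSysPts K D m p) : ℤ) - 1)

/-- The virtual dimension `vdim = #D − 1 − Σ_j C(m_j + 1, 2)`. -/
def vdimSys (D : Finset (ℕ × ℕ)) {r : ℕ} (m : Fin r → ℕ) : ℤ :=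
  (D.card : ℤ) - 1 - ∑ j : Fin r, (((m j + 1).choose 2 : ℕ) : ℤ)

/-- A system is non-special if its dimension equals the expected dimension
`edim = max (vdim, −1)`. -/
def nonSpecial (K : Type*) [Field K] (D : Finset (ℕ × ℕ)) {r : ℕ}
    (m : Fin r → ℕ) : Prop :=
  dimSys K D m = max (vdimSys D m) (-1)

section helpers

lemma fin2_ne : ∀ i j : Fin 2, ¬ j = i → 1 - i = j := by decide
lemma fin2_ne' : ∀ i : Fin 2, 1 - i ≠ i := by decide
lemma fin2_or : ∀ i j : Fin 2, j = i ∨ j = 1 - i := by decide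

variable {K : Type*} [Field K]

/-- order of vanishing at least `m` at `p`, recursively -/
def Van : ℕ → (Fin 2 → K) → MvPolynomial (Fin 2) K → Prop
  | 0, _, _ => True
  | (m+1), p, f => eval p f = 0 ∧ ∀ i, Van m p (pderiv i f)

lemma pderiv_swap (i j : Fin 2) (f : MvPolynomial (Fin 2) K) :
    pderiv i (pderiv j f) = pderiv j (pderiv i f) := by
  have h : ⁅(pderiv i : Derivation K (MvPolynomial (Fin 2) K) (MvPolynomial (Fin 2) K)),
      (pderiv j : Derivation K (MvPolynomial (Fin 2) K) (MvPolynomial (Fin 2) K))⁆ = 0 := by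
    apply MvPolynomial.derivation_ext
    intro l
    rw [Derivation.commutator_apply]
    simp [pderiv_X, Pi.single_apply]
    split_ifs <;> simp
  have := congrArg (fun D => D f) h
  simpa [Derivation.commutator_apply, sub_eq_zero] using this

lemma Van.mono {m : ℕ} : ∀ {p : Fin 2 → K} {f : MvPolynomial (Fin 2) K},
    Van (m+1) p f → Van m p f := by
  induction m with
  | zero => intros; trivial
  | succ m ih => intro p f h; exact ⟨h.1, fun i => ih (h.2 i)⟩

lemma Van.add {m : ℕ} : ∀ {p : Fin 2 → K} {f g : MvPolynomial (Fin 2) K},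
    Van m p f → Van m p g → Van m p (f + g) := by
  induction m with
  | zero => intros; trivial
  | succ m ih =>
    intro p f g h h'
    refine ⟨by simp [h.1, h'.1], fun i => ?_⟩
    rw [map_add]; exact ih (h.2 i) (h'.2 i)

lemma Van.mul {m : ℕ} : ∀ {p : Fin 2 → K} (g : MvPolynomial (Fin 2) K)
    {f : MvPolynomial (Fin 2) K}, Van m p f → Van m p (g * f) := by
  induction m with
  | zero => intros; trivial
  | succ m ih =>
    intro p g f h
    refine ⟨by simp [h.1], fun i => ?_⟩
    rw [pderiv_mul]
    exact (ih _ h.mono).add (ih _ (h.2 i))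

lemma Van.cancel {m : ℕ} : ∀ {p : Fin 2 → K} (g : MvPolynomial (Fin 2) K)
    {f : MvPolynomial (Fin 2) K}, eval p g ≠ 0 → Van m p (g * f) → Van m p f := by
  induction m with
  | zero => intros; trivial
  | succ m ih =>
    intro p g f hg h
    have h1 := ih g hg h.mono
    refine ⟨by simpa [hg] using h.1, fun i => ih g hg ?_⟩
    have h2 := (h.2 i).add (h1.mul (-(pderiv i g)))
    rw [pderiv_mul] at h2
    convert h2 using 1
    ring

lemma Van.peel_aux [CharZero K] {m : ℕ} : ∀ {p : Fin 2 → K} (i : Fin 2) (c : ℕ)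
    {f : MvPolynomial (Fin 2) K}, 
    Van m p (C ((c : K) + 1) * f + (X i - C (p i)) * pderiv i f) → Van m p f := by
  induction m with
  | zero => intros; trivial
  | succ m ih =>
    intro p i c f h
    refine ⟨?_, fun j => ?_⟩
    · have h1 := h.1
      have : (c : K) + 1 ≠ 0 := by exact_mod_cast Nat.succ_ne_zero c
      simpa [this] using h1
    · have h2 := h.2 j
      by_cases hj : j = i
      · subst hj
        apply ih j (c+1)
        convert h2 using 1
        simp
        ring
      · apply ih i c
        convert h2 using 1
        rw [pderiv_swap i j]
        simp [pderiv_X_of_ne (Ne.symm hj)]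

lemma Van.peel [CharZero K] {m : ℕ} {p : Fin 2 → K} (i : Fin 2)
    {f : MvPolynomial (Fin 2) K} (h : Van (m+1) p ((X i - C (p i)) * f)) : Van m p f := by
  apply Van.peel_aux i 0
  have := h.2 i
  convert this using 1
  simp
  ring

/-- restriction to the line `x_i = α` -/
noncomputable def restr (i : Fin 2) (α : K) : MvPolynomial (Fin 2) K →ₐ[K] Polynomial K :=
  aeval (fun j => if j = i then Polynomial.C α else Polynomial.X)

lemma restr_deriv (i : Fin 2) (α : K) (f : MvPolynomial (Fin 2) K) :
    Polynomial.derivative (restr i α f) = restr i α (pderiv (1 - i) f) := by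
  induction f using MvPolynomial.induction_on with
  | C a => simp [restr]
  | add f g hf hg => simp [hf, hg]
  | mul_X f j hf =>
    rw [map_mul, Polynomial.derivative_mul, hf, pderiv_mul, map_add, map_mul, map_mul]
    congr 2
    fin_cases i <;> fin_cases j <;> simp [restr, pderiv_X]

lemma restr_eval (i : Fin 2) (p : Fin 2 → K) (f : MvPolynomial (Fin 2) K) :
    (restr i (p i) f).eval (p (1 - i)) = eval p f := by
  induction f using MvPolynomial.induction_on with
  | C a => simp [restr]
  | add f g hf hg => simp [hf, hg]
  | mul_X f j hf =>
    rw [map_mul, Polynomial.eval_mul, hf, map_mul]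
    congr 1
    fin_cases i <;> fin_cases j <;> simp [restr]

lemma Van.restr_iter {m : ℕ} (i : Fin 2) {p : Fin 2 → K} : ∀ {f : MvPolynomial (Fin 2) K}, 
    Van m p f → ∀ n < m, (Polynomial.derivative^[n] (restr i (p i) f)).IsRoot (p (1 - i)) := by
  induction m with
  | zero => intro f _ n hn; omega
  | succ m ih =>
    intro f h n hn
    cases n with
    | zero => simpa [Polynomial.IsRoot, restr_eval] using h.1
    | succ n =>
      rw [Function.iterate_succ_apply, restr_deriv]
      exact ih (h.2 _) n (by omega)

lemma Van.restr_dvd [CharZero K] {m : ℕ} (i : Fin 2) {p : Fin 2 → K} {f : MvPolynomial (Fin 2) K}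
    (h : Van m p f) : 
    (Polynomial.X - Polynomial.C (p (1 - i))) ^ m ∣ restr i (p i) f := by
  cases m with
  | zero => simp
  | succ m =>
    by_cases h0 : restr i (p i) f = 0
    · simp [h0]
    rw [← Polynomial.le_rootMultiplicity_iff h0]
    apply (Polynomial.lt_rootMultiplicity_iff_isRoot_iterate_derivative h0).2
    intro n hn
    exact h.restr_iter i n (by omega)

lemma restr_natDegree (i : Fin 2) (α : K) (f : MvPolynomial (Fin 2) K) :
    (restr i α f).natDegree ≤ degreeOf (1 - i) f := by
  conv_lhs => rw [f.as_sum]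
  rw [map_sum]
  apply Polynomial.natDegree_sum_le_of_forall_le
  intro s hs
  refine le_trans ?_ (monomial_le_degreeOf (1 - i) hs)
  rw [restr, aeval_monomial]
  rw [Finsupp.prod_fintype _ _ (by simp), Fin.prod_univ_two]
  refine (Polynomial.natDegree_C_mul_le _ _).trans ?_
  fin_cases i
  · simp only [Fin.zero_eta, if_true, Fin.isValue, one_ne_zero, if_false, sub_zero]
    rw [← Polynomial.C_pow]
    exact (Polynomial.natDegree_C_mul_le _ _).trans (Polynomial.natDegree_X_pow_le _)
  · simp only [Fin.mk_one, if_true, Fin.isValue, zero_ne_one, if_false, sub_self]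
    rw [← Polynomial.C_pow]
    exact (Polynomial.natDegree_mul_C_le _ _).trans (Polynomial.natDegree_X_pow_le _)

lemma dvd_of_restr (i : Fin 2) (α : K) (f : MvPolynomial (Fin 2) K) (h : restr i α f = 0) :
    (X i - C α) ∣ f := by
  rw [← Ideal.mem_span_singleton, ← Ideal.Quotient.eq_zero_iff_mem]
  set I := Ideal.span {(X i - C α : MvPolynomial (Fin 2) K)}
  have key : (Ideal.Quotient.mkₐ K I).comp
      ((Polynomial.aeval (X (1 - i) : MvPolynomial (Fin 2) K)).comp (restr i α))
      = Ideal.Quotient.mkₐ K I := by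
    apply MvPolynomial.algHom_ext
    intro j
    by_cases hj : j = i
    · subst hj
      simp only [AlgHom.comp_apply, restr, aeval_X, if_true, Polynomial.aeval_C]
      rw [Ideal.Quotient.mkₐ_eq_mk, Ideal.Quotient.eq, ← neg_mem_iff]
      simpa [I, algebraMap_eq] using Ideal.mem_span_singleton_self (X j - C α : MvPolynomial (Fin 2) K)
    · have : 1 - i = j := fin2_ne _ _ hj
      simp [AlgHom.comp_apply, restr, hj, this]
  have := congrArg (fun F => F f) key
  simp only [AlgHom.comp_apply, h, map_zero, Ideal.Quotient.mkₐ_eq_mk] at this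
  exact this.symm

/-- one line -/
lemma line_dvd [CharZero K] (i : Fin 2) (α : K) (T : Finset K) (m : ℕ)
    (f : MvPolynomial (Fin 2) K) (hd : degreeOf (1 - i) f < T.card * m)
    (hv : ∀ p : Fin 2 → K, p i = α → p (1 - i) ∈ T → Van m p f) : (X i - C α) ∣ f := by
  apply dvd_of_restr
  have hdv : (∏ t ∈ T, (Polynomial.X - Polynomial.C t) ^ m) ∣ restr i α f := by
    apply Finset.prod_dvd_of_coprime
    · intro s _ t _ hst
      exact (Polynomial.isCoprime_X_sub_C_of_isUnit_sub
        (sub_ne_zero_of_ne hst).isUnit).pow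
    · intro t ht
      have hne : 1 - i ≠ i := fin2_ne' i
      have h := (hv (fun j => if j = i then α else t) (by simp) (by simp [hne, ht])).restr_dvd i
      simpa [hne] using h
  by_contra h0
  have h1 := Polynomial.natDegree_le_of_dvd hdv h0
  rw [Polynomial.natDegree_prod _ _ (fun t _ => pow_ne_zero _ (Polynomial.X_sub_C_ne_zero t))] at h1
  simp at h1
  have := restr_natDegree i α f
  omega

lemma XC_ne (i : Fin 2) (α : K) : (X i - C α : MvPolynomial (Fin 2) K) ≠ 0 := by
  intro h
  have := congrArg (pderiv i) h
  simp at this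

lemma XC_deg (i : Fin 2) (α : K) : 1 ≤ degreeOf i (X i - C α : MvPolynomial (Fin 2) K) := by
  have : (Finsupp.single i 1) ∈ (X i - C α : MvPolynomial (Fin 2) K).support := by
    have h0 : (0 : Fin 2 →₀ ℕ) ≠ Finsupp.single i 1 := by
      intro h
      have := congrArg (fun s => s i) h
      simp at this
    rw [mem_support_iff, coeff_sub, coeff_C, if_neg h0]
    simp
  simpa using le_degreeOf_of_mem_support i this

lemma rect_zero [CharZero K] (S : Fin 2 → Fin 2 → Finset K) (n : Fin 2 → ℕ)
    (hS : ∀ i c, (S i c).card = n i) (hdis : ∀ i, Disjoint (S i 0) (S i 1)) (m : ℕ) :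
    ∀ (i : Fin 2) (f : MvPolynomial (Fin 2) K), f ≠ 0 →
      degreeOf i f < n i * (m + 1) → degreeOf (1 - i) f < n (1 - i) * m →
      ¬ (∀ (c : Fin 2) (p : Fin 2 → K), (∀ j, p j ∈ S j c) → Van m p f) := by
  classical
  induction m with
  | zero => intro i f _ _ h; omega
  | succ m ih =>
    intro i f hf h1 h2 hv
    have hii : 1 - (1 - i) = i := by simp
    have hij : ∀ j, j = i ∨ j = 1 - i := fun j => fin2_or i j
    set U := S i 0 ∪ S i 1 with hU
    have hUc : U.card = 2 * n i := by
      rw [hU, Finset.card_union_of_disjoint (hdis i), hS, hS]; ring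
    have hdv : (∏ α ∈ U, (X i - C α : MvPolynomial (Fin 2) K)) ∣ f := by
      apply Finset.prod_dvd_of_coprime
      · intro s _ t _ hst
        refine ⟨C (t - s)⁻¹, -C (t - s)⁻¹, ?_⟩
        have : (t - s) ≠ 0 := sub_ne_zero_of_ne (Ne.symm hst)
        calc _ = C (t - s)⁻¹ * (C t - C s : MvPolynomial (Fin 2) K) := by ring
          _ = 1 := by rw [← C_sub, ← C_mul, inv_mul_cancel₀ this, C_1]
      · intro α hα
        have : ∃ c, α ∈ S i c := by
          rcases Finset.mem_union.1 hα with h | h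
          exacts [⟨0, h⟩, ⟨1, h⟩]
        obtain ⟨c, hc⟩ := this
        apply line_dvd i α (S (1 - i) c) (m + 1) f (by rwa [hS])
        intro p hp hp'
        apply hv c p
        intro j
        rcases hij j with rfl | rfl
        · rwa [hp]
        · exact hp'
    obtain ⟨g, rfl⟩ := hdv
    have hg : g ≠ 0 := right_ne_zero_of_mul hf
    have hP := left_ne_zero_of_mul hf
    rw [degreeOf_mul_eq hP hg] at h1 h2
    have hPd : 2 * n i ≤ degreeOf i (∏ α ∈ U, (X i - C α : MvPolynomial (Fin 2) K)) := by
      rw [degreeOf_prod_eq _ _ (fun α _ => XC_ne i α), ← hUc, Finset.card_eq_sum_ones]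
      exact Finset.sum_le_sum fun α _ => XC_deg i α
    refine ih (1 - i) g hg (by omega) ?_ ?_
    · rw [hii]; nlinarith
    · intro c p hp
      have hpU : p i ∈ U := by
        rw [hU, Finset.mem_union]
        have := hp i
        fin_cases c
        exacts [Or.inl this, Or.inr this]
      have h := hv c p hp
      rw [← Finset.mul_prod_erase _ _ hpU, mul_assoc] at h
      refine Van.cancel _ ?_ h.peel
      rw [eval_prod, Finset.prod_ne_zero_iff]
      intro α hα
      simp [sub_eq_zero]
      exact (Finset.ne_of_mem_erase hα).symm


/-- the substitution `X = u w`, `Y = w` -/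
noncomputable def sbst (K : Type*) [Field K] :
    MvPolynomial (Fin 2) K →ₐ[K] MvPolynomial (Fin 2) K :=
  aeval (fun j : Fin 2 => if j = 0 then X 0 * X 1 else X 1)

lemma sbst_eval (p : Fin 2 → K) (f : MvPolynomial (Fin 2) K) :
    eval p (sbst K f) = eval (fun j => if j = 0 then p 0 * p 1 else p 1) f := by
  induction f using MvPolynomial.induction_on with
  | C a => simp [sbst, algebraMap_eq]
  | add f g hf hg => simp [hf, hg]
  | mul_X f j hf =>
    rw [map_mul, map_mul, hf, map_mul]
    congr 1
    fin_cases j <;> simp [sbst]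

lemma sbst_d0 (f : MvPolynomial (Fin 2) K) :
    pderiv 0 (sbst K f) = X 1 * sbst K (pderiv 0 f) := by
  induction f using MvPolynomial.induction_on with
  | C a => simp [sbst, algebraMap_eq]
  | add f g hf hg => simp [hf, hg, mul_add]
  | mul_X f j hf =>
    rw [map_mul, pderiv_mul, hf, pderiv_mul, map_add, map_mul, map_mul]
    fin_cases j <;> simp [sbst, pderiv_X] <;> ring

lemma sbst_d1 (f : MvPolynomial (Fin 2) K) :
    pderiv 1 (sbst K f) = X 0 * sbst K (pderiv 0 f) + sbst K (pderiv 1 f) := by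
  induction f using MvPolynomial.induction_on with
  | C a => simp [sbst, algebraMap_eq]
  | add f g hf hg => simp only [map_add, hf, hg, mul_add]; ring
  | mul_X f j hf =>
    rw [map_mul, pderiv_mul, hf, pderiv_mul, pderiv_mul, map_add, map_mul, map_mul, map_add,
      map_mul, map_mul]
    fin_cases j <;> simp [sbst, pderiv_X] <;> ring

lemma Van.sbst {m : ℕ} {p : Fin 2 → K} : ∀ {f : MvPolynomial (Fin 2) K},
    Van m (fun j => if j = 0 then p 0 * p 1 else p 1) f → Van m p (sbst K f) := by
  induction m with
  | zero => intros; trivial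
  | succ m ih =>
    intro f h
    refine ⟨by rw [sbst_eval]; exact h.1, fun i => ?_⟩
    fin_cases i
    · simp only [Fin.zero_eta, sbst_d0]
      exact (ih (h.2 0)).mul _
    · simp only [Fin.mk_one, sbst_d1]
      exact ((ih (h.2 0)).mul _).add (ih (h.2 1))

lemma sbst_inj {f : MvPolynomial (Fin 2) K} (h : sbst K f = 0) : f = 0 := by
  let F := FractionRing (MvPolynomial (Fin 2) K)
  let ι : MvPolynomial (Fin 2) K →ₐ[K] F := Algebra.algHom K _ _
  have hι : Function.Injective ι := IsFractionRing.injective (MvPolynomial (Fin 2) K) F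
  have hX : ι (X 1) ≠ 0 := by
    rw [Ne, map_eq_zero_iff ι hι]; exact X_ne_zero 1
  have key : (aeval (fun j : Fin 2 => if j = 0 then ι (X 0) / ι (X 1) else ι (X 1))).comp (sbst K)
      = ι := by
    apply MvPolynomial.algHom_ext
    intro j
    fin_cases j
    · simp [sbst, div_mul_cancel₀ _ hX]
    · simp [sbst]
  have := congrArg (fun F => F f) key
  simp only [AlgHom.comp_apply, h, map_zero] at this
  exact hι (by rw [map_zero]; exact this.symm)

lemma derivOp_van {m : ℕ} (p : K × K) : ∀ {f : MvPolynomial (Fin 2) K},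
    (∀ β : ℕ × ℕ, β.1 + β.2 < m → evalPt K p (derivOp K β f) = 0) →
    Van m (fun j => if j = 0 then p.1 else p.2) f := by
  induction m with
  | zero => intros; trivial
  | succ m ih =>
    intro f h
    refine ⟨?_, fun i => ih fun β hβ => ?_⟩
    · have := h (0, 0) (by simp)
      simpa [derivOp, evalPt, aeval_eq_eval] using this
    · have hc : Commute ((pderiv (1 : Fin 2) : Derivation K (MvPolynomial (Fin 2) K)
          (MvPolynomial (Fin 2) K)).toLinearMap : Module.End K _)
          (pderiv (0 : Fin 2)).toLinearMap := by
        apply LinearMap.ext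
        intro g
        exact pderiv_swap 1 0 g
      fin_cases i
      · have := h (β.1 + 1, β.2) (by simp; omega)
        convert this using 2
        simp only [derivOp]
        rw [pow_succ, mul_assoc, ← (hc.pow_left β.2).eq, ← mul_assoc]
        rfl
      · have := h (β.1, β.2 + 1) (by simp; omega)
        convert this using 2
        simp only [derivOp]
        rw [pow_succ, ← mul_assoc]
        rfl

lemma sbst_mono (k h : ℕ) (hk : 0 < k) (hh : 0 < h) (f : MvPolynomial (Fin 2) K)
    (hf : f ∈ monoSpan K ((Finset.range k ×ˢ Finset.range (k + h)).filter
          fun d => k - 1 ≤ d.1 + d.2 ∧ d.1 + d.2 ≤ k + h - 2)) :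
    ∃ g, sbst K f = X 1 ^ (k - 1) * g ∧ degreeOf 0 g < k ∧ degreeOf 1 g < h := by
  unfold monoSpan at hf
  induction hf using Submodule.span_induction with
  | mem x hx =>
    obtain ⟨⟨a, b⟩, hd, rfl⟩ := hx
    simp at hd
    refine ⟨monomial (Finsupp.single 0 a + Finsupp.single 1 (a + b - (k - 1))) 1, ?_, ?_, ?_⟩
    · rw [sbst, aeval_monomial, Finsupp.prod_fintype _ _ (by simp), Fin.prod_univ_two]
      rw [monomial_eq, Finsupp.prod_fintype _ _ (by simp), Fin.prod_univ_two]
      simp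
      rw [mul_pow, mul_assoc, ← pow_add, mul_left_comm, ← pow_add]
      congr 2
      omega
    · rw [degreeOf_monomial_eq _ _ one_ne_zero]; simp; omega
    · rw [degreeOf_monomial_eq _ _ one_ne_zero]; simp; omega
  | zero => exact ⟨0, by simp, by simpa, by simpa⟩
  | add x y _ _ hx hy =>
    obtain ⟨g, h1, h2, h3⟩ := hx
    obtain ⟨g', h1', h2', h3'⟩ := hy
    exact ⟨g + g', by rw [map_add, h1, h1', mul_add],
      (degreeOf_add_le _ _ _).trans_lt (max_lt h2 h2'),
      (degreeOf_add_le _ _ _).trans_lt (max_lt h3 h3')⟩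
  | smul c x _ hx =>
    obtain ⟨g, h1, h2, h3⟩ := hx
    refine ⟨C c * g, ?_, (degreeOf_C_mul_le _ _ _).trans_lt h2,
      (degreeOf_C_mul_le _ _ _).trans_lt h3⟩
    rw [map_smul, h1, smul_eq_C_mul]; ring

lemma card_D (k h : ℕ) (hk : 0 < k) (hh : 0 < h) :
    ((Finset.range k ×ˢ Finset.range (k + h)).filter
          fun d => k - 1 ≤ d.1 + d.2 ∧ d.1 + d.2 ≤ k + h - 2).card = k * h := by
  rw [← Finset.card_range k, ← Finset.card_range h, ← Finset.card_product]
  simp only [Finset.card_range]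
  refine Finset.card_nbij' (fun d => (d.1, d.1 + d.2 - (k - 1)))
    (fun d => (d.1, d.2 + (k - 1) - d.1)) ?_ ?_ ?_ ?_
  · rintro ⟨a, b⟩ hd; simp at hd ⊢; omega
  · rintro ⟨a, b⟩ hd; simp at hd ⊢; omega
  · rintro ⟨a, b⟩ hd; simp at hd ⊢; omega
  · rintro ⟨a, b⟩ hd; simp at hd ⊢; omega

lemma exists_pts [CharZero K] (m a b k h : ℕ) (hk : 0 < k) (hh : 0 < h)
    (hka : k = (m + 1) * a) (hhb : h = m * b) :
    ∃ p : Fin (2 * (a * b)) → K × K,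
      linSysPts K ((Finset.range k ×ˢ Finset.range (k + h)).filter
          fun d => k - 1 ≤ d.1 + d.2 ∧ d.1 + d.2 ≤ k + h - 2)
          (fun _ => m) p = ⊥ := by
  classical
  let n : Fin 2 → ℕ := fun i => if i = 0 then a else b
  let x : Fin 2 → ℕ → ℕ → K := fun i c j => ((c * n i + j + 1 : ℕ) : K)
  let S : Fin 2 → Fin 2 → Finset K := fun i c => (Finset.range (n i)).image (x i c)
  let e : Fin (2 * (a * b)) ≃ Fin 2 × Fin a × Fin b :=
    (Fintype.equivFinOfCardEq (by simp)).symm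
  let p : Fin (2 * (a * b)) → K × K := fun j =>
    (x 0 (e j).1 (e j).2.1 * x 1 (e j).1 (e j).2.2, x 1 (e j).1 (e j).2.2)
  refine ⟨p, ?_⟩
  rw [eq_bot_iff]
  intro f hf
  simp only [linSysPts, Submodule.mem_inf, Submodule.mem_iInf, LinearMap.mem_ker,
    LinearMap.comp_apply] at hf
  obtain ⟨hfD, hfv⟩ := hf
  obtain ⟨g, h1, h2, h3⟩ := sbst_mono _ _ hk hh f hfD
  have hcard : ∀ i c, (S i c).card = n i := by
    intro i c
    rw [Finset.card_image_of_injective, Finset.card_range]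
    intro j j' hj
    have : c * n i + j + 1 = c * n i + j' + 1 := Nat.cast_injective (R := K) hj
    omega
  have hdis : ∀ i, Disjoint (S i 0) (S i 1) := by
    intro i
    rw [Finset.disjoint_left]
    intro t ht ht'
    simp only [S, Finset.mem_image, Finset.mem_range] at ht ht'
    obtain ⟨j, hj, rfl⟩ := ht
    obtain ⟨j', hj', h⟩ := ht'
    have : ((1 : Fin 2) : ℕ) * n i + j' + 1 = ((0 : Fin 2) : ℕ) * n i + j + 1 :=
      Nat.cast_injective (R := K) h
    simp at this
    omega
  have hg : g = 0 := by
    by_contra hg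
    refine rect_zero S n hcard hdis m 0 g hg (by simpa [n, hka, mul_comm] using h2)
      (by simpa [n, hhb, mul_comm] using h3) ?_
    intro c q hq
    have hq0 := hq 0
    have hq1 := hq 1
    simp only [S, Finset.mem_image, Finset.mem_range] at hq0 hq1
    obtain ⟨j0, hj0, hx0⟩ := hq0
    obtain ⟨j1, hj1, hx1⟩ := hq1
    have hj0' : j0 < a := by simpa [n] using hj0
    have hj1' : j1 < b := by simpa [n] using hj1
    have hv := derivOp_van _ (hfv (e.symm (c, ⟨j0, hj0'⟩, ⟨j1, hj1'⟩)))
    simp only [p, Equiv.apply_symm_apply, hx0, hx1] at hv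
    have hv' := Van.sbst hv
    rw [h1] at hv'
    refine hv'.cancel _ ?_
    rw [map_pow, eval_X, ← hx1]
    apply pow_ne_zero
    simp only [x]
    exact Nat.cast_ne_zero.2 (Nat.succ_ne_zero _)
  rw [hg, mul_zero] at h1
  exact sbst_inj h1

end helpers

/-- Let `m, k, h ≥ 1` with `(m+1) ∣ k` and `m ∣ h`, and
`D = (h^{↑k−1}, h^{↑k−2}, …, h^{↑0}) = {(i,j) : i ≤ k−1, k−1−i ≤ j ≤ k+h−2−i}`.
Then `L = L_D(m^{×2kh/(m(m+1))})` is non-special and `vdim L = −1`. -/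
theorem statement10 {K : Type*} [Field K] [CharZero K]
    (m k h : ℕ) (hm : 0 < m) (hk : 0 < k) (hh : 0 < h)
    (hdvdk : (m + 1) ∣ k) (hdvdh : m ∣ h) :
    nonSpecial K
        ((Finset.range k ×ˢ Finset.range (k + h)).filter
          fun d => k - 1 ≤ d.1 + d.2 ∧ d.1 + d.2 ≤ k + h - 2)
        (fun _ : Fin (2 * (k * h / (m * (m + 1)))) => m) ∧
      vdimSys ((Finset.range k ×ˢ Finset.range (k + h)).filter
          fun d => k - 1 ≤ d.1 + d.2 ∧ d.1 + d.2 ≤ k + h - 2)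
        (fun _ : Fin (2 * (k * h / (m * (m + 1)))) => m) = -1 := by
  obtain ⟨a, rfl⟩ := hdvdk
  obtain ⟨b, rfl⟩ := hdvdh
  have ha : 0 < a := Nat.pos_of_mul_pos_left hk
  have hb : 0 < b := Nat.pos_of_mul_pos_left hh
  have hr : (m + 1) * a * (m * b) / (m * (m + 1)) = a * b := by
    apply Nat.div_eq_of_eq_mul_left (by positivity)
    ring
  rw [hr]
  have hvd : vdimSys ((Finset.range ((m + 1) * a) ×ˢ
      Finset.range ((m + 1) * a + m * b)).filter
          fun d => (m + 1) * a - 1 ≤ d.1 + d.2 ∧ d.1 + d.2 ≤ (m + 1) * a + m * b - 2)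
        (fun _ : Fin (2 * (a * b)) => m) = -1 := by
    rw [vdimSys, card_D _ _ hk hh]
    have h2 : (m + 1).choose 2 * 2 = (m + 1) * m := by
      rw [Nat.choose_two_right, Nat.add_sub_cancel]
      exact Nat.div_mul_cancel (by rw [mul_comm]; exact (Nat.even_mul_succ_self m).two_dvd)
    have h3 : (((m + 1).choose 2 : ℕ) : ℤ) * 2 = (m + 1) * m := by exact_mod_cast h2
    simp only [Finset.sum_const, Finset.card_univ, Fintype.card_fin, nsmul_eq_mul]
    push_cast
    linear_combination (-(a : ℤ) * b) * h3
  refine ⟨?_, hvd⟩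
  rw [nonSpecial, hvd, max_self, dimSys]
  obtain ⟨p, hp⟩ := exists_pts (K := K) m a b _ _ hk hh rfl rfl
  apply le_antisymm
  · apply csInf_le
    · refine ⟨-1, ?_⟩
      rintro _ ⟨q, rfl⟩
      dsimp only
      omega
    · refine ⟨p, ?_⟩
      dsimp only
      rw [hp, finrank_bot]
      simp
  · apply le_csInf (Set.range_nonempty _)
    rintro _ ⟨q, rfl⟩
    dsimp only
    omega
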